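/- arXiv:1608.06811 — 4 statements merged into one kernel-verified Lean document; each statement's English description precedes it below -/
import Mathlib

section
/- Let M be a ℤ[x]-lattice. Then N = Hom_{ℤ[x]}(M, ℤ[x]) is a free ℤ[x]-module, and the rank of N equals the rank of M. -/
open Polynomial TensorProduct

namespace SeshadriAux

/-- Size of a polynomial over a finite prime field, `0` for the zero polynomial. -/
noncomputable def msr {p : ℕ} (q : (ZMod p)[X]) : ℕ :=
  open Classical in if q = 0 then 0 else q.natDegree + 1

lemma msr_lt {p : ℕ} {q r : (ZMod p)[X]} (h : q.degree < r.degree) : msr q < msr r := by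
  have hr : r ≠ 0 := by
    rintro rfl
    simp at h
  by_cases hq : q = 0
  · simp [msr, hq, hr]
  · have := natDegree_lt_natDegree hq h
    simp [msr, hq, hr, this]

/-- Reduction mod `p`. -/
noncomputable abbrev red (p : ℕ) : ℤ[X] →+* (ZMod p)[X] := mapRingHom (Int.castRingHom (ZMod p))

lemma red_eq_zero {p : ℕ} (a : ℤ[X]) : red p a = 0 ↔ C (p : ℤ) ∣ a := by
  rw [C_dvd_iff_dvd_coeff, Polynomial.ext_iff]
  refine forall_congr' fun i => ?_
  rw [coe_mapRingHom, coeff_map, coeff_zero, eq_intCast]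
  exact CharP.intCast_eq_zero_iff (ZMod p) p _

lemma red_surj (p : ℕ) : Function.Surjective (red p) :=
  map_surjective _ ZMod.intCast_surjective

variable {N : Type*} [AddCommGroup N] [Module ℤ[X] N] {ι : Type*} [Fintype ι] [DecidableEq ι]

lemma transvection {b : ι → N} (hb : LinearIndependent ℤ[X] b) {i j : ι} (hij : i ≠ j) (q : ℤ[X]) :
    LinearIndependent ℤ[X] (b + Pi.single j (q • b i)) ∧
    Submodule.span ℤ[X] (Set.range b) ≤
      Submodule.span ℤ[X] (Set.range (b + Pi.single j (q • b i))) := by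
  constructor
  · rw [Fintype.linearIndependent_iff] at hb ⊢
    intro g hg
    have key : ∑ k, (g + Pi.single i (q * g j) : ι → ℤ[X]) k • b k = 0 := by
      rw [← hg]
      simp only [Pi.add_apply, add_smul, smul_add, Finset.sum_add_distrib, Pi.single_apply,
        ite_smul, smul_ite, zero_smul, smul_zero, Finset.sum_ite_eq', Finset.sum_ite_eq,
        Finset.mem_univ, if_true]
      rw [smul_smul, mul_comm]
    have h := hb _ key
    have hj : g j = 0 := by simpa [Pi.single_apply, hij.symm] using h j
    intro k
    simpa [hj] using h k
  · rw [Submodule.span_le]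
    have mem : ∀ k, (b + Pi.single j (q • b i) : ι → N) k ∈
      Submodule.span ℤ[X] (Set.range (b + Pi.single j (q • b i))) := fun k =>
        Submodule.subset_span ⟨k, rfl⟩
    have hi : b i ∈ Submodule.span ℤ[X] (Set.range (b + Pi.single j (q • b i))) := by
      simpa [Pi.single_apply, hij] using mem i
    rintro _ ⟨k, rfl⟩
    by_cases hk : k = j
    · subst hk
      have := Submodule.sub_mem _ (mem k) (Submodule.smul_mem _ q hi)
      simpa using this
    · simpa [Pi.single_apply, hk] using mem k

lemma divide {b : ι → N} (hb : LinearIndependent ℤ[X] b) {i : ι} {p : ℕ} (hp : p.Prime) {c : N}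
    (hc : b i = C (p : ℤ) • c) :
    LinearIndependent ℤ[X] (Function.update b i c) ∧
    Submodule.span ℤ[X] (Set.range b) <
      Submodule.span ℤ[X] (Set.range (Function.update b i c)) := by
  have hp0 : C (p : ℤ) ≠ 0 := by simpa using hp.ne_zero
  have hcm : c ∈ Submodule.span ℤ[X] (Set.range (Function.update b i c)) :=
    Submodule.subset_span ⟨i, by simp⟩
  refine ⟨?_, lt_of_le_of_ne ?_ ?_⟩
  · rw [Fintype.linearIndependent_iff] at hb ⊢
    intro g hg
    have key : ∑ k, (if k = i then g k else C (p : ℤ) * g k) • b k = 0 := by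
      rw [← smul_zero (C (p : ℤ)), ← hg, Finset.smul_sum]
      refine Finset.sum_congr rfl fun k _ => ?_
      by_cases hk : k = i
      · subst hk
        simp [hc, smul_smul, mul_comm]
      · simp [hk, smul_smul]
    intro k
    have := hb _ key k
    by_cases hk : k = i
    · simpa [hk] using this
    · simp only [hk, if_false, mul_eq_zero] at this
      exact this.resolve_left hp0
  · rw [Submodule.span_le]
    rintro _ ⟨k, rfl⟩
    by_cases hk : k = i
    · subst hk
      rw [hc]
      exact Submodule.smul_mem _ _ hcm
    · exact Submodule.subset_span ⟨k, by simp [hk]⟩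
  · intro heq
    rw [← heq, Submodule.mem_span_range_iff_exists_fun] at hcm
    obtain ⟨g, hg⟩ := hcm
    rw [Fintype.linearIndependent_iff] at hb
    have key : ∑ k, ((C (p : ℤ) * g k) - (Pi.single i 1 : ι → ℤ[X]) k) • b k = 0 := by
      simp only [sub_smul, Finset.sum_sub_distrib, mul_smul, ← Finset.smul_sum, hg]
      simp only [Pi.single_apply, ite_smul, one_smul, zero_smul, Finset.sum_ite_eq',
        Finset.mem_univ, if_true, hc, sub_self]
    have := hb _ key i
    simp only [Pi.single_eq_same, sub_eq_zero] at this
    have h1 : IsUnit (C (p : ℤ)) := IsUnit.of_mul_eq_one _ this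
    rw [isUnit_C, Int.isUnit_iff] at h1
    have := hp.two_le
    omega

lemma update_eq (a : ι → ℤ[X]) (i : ι) (x : ℤ[X]) :
    Function.update a i (a i - x) = a - Pi.single i x := by
  funext l
  by_cases hl : l = i
  · subst hl
    rw [Function.update_self, Pi.sub_apply, Pi.single_eq_same]
  · rw [Function.update_of_ne hl, Pi.sub_apply, Pi.single_eq_of_ne hl, sub_zero]

lemma step {p : ℕ} [hp : Fact p.Prime]
    (H : ∀ (a : ℤ[X]) (n m : N), ¬ C (p : ℤ) ∣ a → a • n = C (p : ℤ) • m →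
      ∃ c, n = C (p : ℤ) • c) :
    ∀ (k : ℕ) (b : ι → N) (a : ι → ℤ[X]) (y : N), ∑ i, msr (red p (a i)) = k →
      LinearIndependent ℤ[X] b → (∃ i, red p (a i) ≠ 0) → ∑ i, a i • b i = C (p : ℤ) • y →
      ∃ b' : ι → N, LinearIndependent ℤ[X] b' ∧
        Submodule.span ℤ[X] (Set.range b) < Submodule.span ℤ[X] (Set.range b') := by
  intro k
  induction k using Nat.strong_induction_on with
  | _ k ih =>
  intro b a y hk hb ha hy
  by_cases h2 : ∃ i j, i ≠ j ∧ red p (a j) ≠ 0 ∧ (red p (a j)).degree ≤ (red p (a i)).degree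
  · obtain ⟨i, j, hij, hj0, hdeg⟩ := h2
    obtain ⟨q, hq⟩ := red_surj p (red p (a i) / red p (a j))
    obtain ⟨hb', hle⟩ := transvection hb hij q
    have hred : red p (a i - q * a j) = red p (a i) % red p (a j) := by
      rw [map_sub, map_mul, hq, EuclideanDomain.mod_eq_sub_mul_div, mul_comm]
    have hlt : msr (red p (a i - q * a j)) < msr (red p (a i)) := by
      rw [hred]
      exact msr_lt (lt_of_lt_of_le (EuclideanDomain.mod_lt _ hj0) hdeg)
    obtain ⟨a', ha'⟩ : ∃ a' : ι → ℤ[X], a' = Function.update a i (a i - q * a j) := ⟨_, rfl⟩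
    have hi' : a' i = a i - q * a j := by rw [ha', Function.update_self]
    have hl' : ∀ l, l ≠ i → a' l = a l := fun l hl => by rw [ha', Function.update_of_ne hl]
    have hsum : ∑ l, msr (red p (a' l)) < k := by
      rw [← hk]
      refine Finset.sum_lt_sum (fun l _ => ?_) ⟨i, Finset.mem_univ _, by rwa [hi']⟩
      by_cases hl : l = i
      · rw [hl, hi']
        exact hlt.le
      · rw [hl' l hl]
    have hrel : ∑ l, a' l • (b + Pi.single j (q • b i) : ι → N) l = C (p : ℤ) • y := by
      rw [ha', update_eq, ← hy]
      simp only [Pi.add_apply, Pi.sub_apply, sub_smul, smul_add, Finset.sum_add_distrib,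
        Finset.sum_sub_distrib, Pi.single_apply,
        ite_smul, smul_ite, zero_smul, smul_zero, Finset.sum_ite_eq', Finset.sum_ite_eq,
        Finset.mem_univ, if_true, hij.symm, if_false]
      rw [smul_smul, mul_comm]
      abel
    have hne : ∃ l, red p (a' l) ≠ 0 := ⟨j, by rwa [hl' j hij.symm]⟩
    obtain ⟨b', hb'1, hb'2⟩ := ih _ hsum _ a' y rfl hb' hne hrel
    exact ⟨b', hb'1, hle.trans_lt hb'2⟩
  · push Not at h2
    obtain ⟨i, hi⟩ := ha
    have hz : ∀ l, l ≠ i → C (p : ℤ) ∣ a l := by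
      intro l hl
      rw [← red_eq_zero]
      by_contra hl0
      exact lt_asymm (h2 l i hl hi) (h2 i l hl.symm hl0)
    choose! d hd using hz
    obtain ⟨c, hc⟩ := H (a i) (b i) (y - ∑ l ∈ Finset.univ.erase i, d l • b l)
      (by rwa [← red_eq_zero]) (by
        rw [smul_sub, ← hy, ← Finset.add_sum_erase _ _ (Finset.mem_univ i), Finset.smul_sum,
          eq_sub_iff_add_eq]
        congr 1
        refine Finset.sum_congr rfl fun l hl => ?_
        rw [smul_smul, ← hd l (Finset.ne_of_mem_erase hl)])
    exact ⟨_, divide hb hp.out hc⟩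

/-- From an element outside a submodule which has an integer multiple inside, get such an element
with prime multiple. -/
lemma exists_prime_mul (F : Submodule ℤ[X] N) : ∀ (s : ℕ), s ≠ 0 → ∀ n : N, n ∉ F →
    C (s : ℤ) • n ∈ F → ∃ (p : ℕ) (n' : N), p.Prime ∧ n' ∉ F ∧ C (p : ℤ) • n' ∈ F := by
  intro s
  induction s using Nat.recOnMul with
  | zero => intro h; exact absurd rfl h
  | one => intro _ n h1 h2; exact absurd (by simpa using h2) h1
  | prime p hp => intro _ n h1 h2; exact ⟨p, n, hp, h1, h2⟩
  | mul s t hs ht =>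
    intro h0 n h1 h2
    by_cases h3 : C (t : ℤ) • n ∈ F
    · exact ht (right_ne_zero_of_mul h0) n h1 h3
    · refine hs (left_ne_zero_of_mul h0) _ h3 ?_
      rw [smul_smul, ← C_mul]
      exact_mod_cast h2

attribute [local instance] Polynomial.algebra Polynomial.isLocalization

lemma initial [Module.Finite ℤ[X] N] [Module.IsTorsionFree ℤ[X] N] :
    ∃ (r : ℕ) (b : Fin r → N), LinearIndependent ℤ[X] b ∧
      ∀ n : N, ∃ s : ℕ, s ≠ 0 ∧ C (s : ℤ) • n ∈ Submodule.span ℤ[X] (Set.range b) := by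
  let S : Submonoid ℤ[X] := Submonoid.map C (nonZeroDivisors ℤ)
  have : IsLocalization S ℚ[X] := Polynomial.isLocalization _ _
  let f : N →ₗ[ℤ[X]] ℚ[X] ⊗[ℤ[X]] N := TensorProduct.mk ℤ[X] ℚ[X] N 1
  have hf : IsLocalizedModule S f :=
    (isLocalizedModule_iff_isBaseChange S ℚ[X] _).mpr (TensorProduct.isBaseChange _ _ _)
  have : Module.IsTorsionFree ℚ[X] (ℚ[X] ⊗[ℤ[X]] N) := IsLocalizedModule.isTorsionFree f S
  obtain ⟨r, c⟩ : Σ n, Module.Basis (Fin n) ℚ[X] (ℚ[X] ⊗[ℤ[X]] N) :=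
    Module.basisOfFiniteTypeTorsionFree'
  choose b hb using fun i => IsLocalizedModule.surj S f (c i)
  have hu : ∀ i, IsUnit (algebraMap ℤ[X] ℚ[X] (b i).2) := fun i => IsLocalization.map_units _ _
  let c' := c.isUnitSMul hu
  have hc' : ∀ i, c' i = f (b i).1 := by
    intro i
    rw [Module.Basis.isUnitSMul_apply, ← hb i, algebraMap_smul]
    rfl
  refine ⟨r, fun i => (b i).1, ?_, ?_⟩
  · apply LinearIndependent.of_comp f
    have h1 : LinearIndependent ℚ[X] (f ∘ fun i => (b i).1) := by
      convert c'.linearIndependent using 1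
      ext1 i
      exact (hc' i).symm
    refine h1.restrict_scalars' _
  · intro n
    obtain ⟨s, hs⟩ := IsLocalization.exist_integer_multiples_of_finite S
      (fun i => c'.repr (f n) i)
    choose g hg using hs
    have h1 : f ((s : ℤ[X]) • n) = f (∑ i, g i • (b i).1) := by
      rw [map_smul, map_sum]
      conv_lhs => rw [← c'.sum_repr (f n)]
      rw [Finset.smul_sum]
      refine Finset.sum_congr rfl fun i _ => ?_
      rw [map_smul, ← hc', ← algebraMap_smul ℚ[X] (g i), hg, smul_assoc]
    obtain ⟨t, ht⟩ := (IsLocalizedModule.eq_iff_exists S f).mp h1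
    obtain ⟨z, hz, hz'⟩ := (s * t).2
    have hz0 : z ≠ 0 := nonZeroDivisors.ne_zero hz
    have hmem : C z • n ∈ Submodule.span ℤ[X] (Set.range fun i => (b i).1) := by
      have : C z • n = (t : ℤ[X]) • ∑ i, g i • (b i).1 := by
        rw [show C z = (s : ℤ[X]) * t from hz', mul_comm, mul_smul]
        exact ht
      rw [this]
      exact Submodule.smul_mem _ _ (Submodule.sum_mem _ fun i _ => Submodule.smul_mem _ _
        (Submodule.subset_span ⟨i, rfl⟩))
    refine ⟨z.natAbs, by simpa using hz0, ?_⟩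
    rcases Int.natAbs_eq z with h | h
    · rw [← h]; exact hmem
    · rw [show ((z.natAbs : ℕ) : ℤ) = -z by omega, C_neg, neg_smul]
      exact Submodule.neg_mem _ hmem

theorem free_of_saturated [Module.Finite ℤ[X] N] [Module.IsTorsionFree ℤ[X] N]
    (H : ∀ (p : ℕ), p.Prime → ∀ (a : ℤ[X]) (n m : N), ¬ C (p : ℤ) ∣ a →
      a • n = C (p : ℤ) • m → ∃ c, n = C (p : ℤ) • c) : Module.Free ℤ[X] N := by
  obtain ⟨r, b₀, hb₀, hs₀⟩ := initial (N := N)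
  let P : Set (Submodule ℤ[X] N) := {F | ∃ b : Fin r → N, LinearIndependent ℤ[X] b ∧
    F = Submodule.span ℤ[X] (Set.range b) ∧ Submodule.span ℤ[X] (Set.range b₀) ≤ F}
  have : IsNoetherian ℤ[X] N := isNoetherian_of_isNoetherianRing_of_finite _ _
  obtain ⟨F, ⟨b, hb, rfl, hle⟩, hmax⟩ := set_has_maximal_iff_noetherian.mpr this P
    ⟨_, b₀, hb₀, rfl, le_rfl⟩
  suffices h : ⊤ ≤ Submodule.span ℤ[X] (Set.range b) from
    Module.Free.of_basis (Module.Basis.mk hb h)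
  by_contra hcon
  obtain ⟨n, -, hn⟩ := SetLike.not_le_iff_exists.mp hcon
  obtain ⟨s, hs0, hs⟩ := hs₀ n
  obtain ⟨p, y, hp, hy, hpy⟩ := exists_prime_mul _ s hs0 n hn (hle hs)
  have : Fact p.Prime := ⟨hp⟩
  have hp0 : C (p : ℤ) ≠ 0 := by simpa using hp.ne_zero
  obtain ⟨a, ha⟩ := (Submodule.mem_span_range_iff_exists_fun _).mp hpy
  obtain ⟨b', hb', hlt⟩ := step (H p hp) _ b a y rfl hb (by
    by_contra! hall
    simp only [red_eq_zero] at hall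
    choose d hd using hall
    apply hy
    have : y = ∑ i, d i • b i := by
      apply smul_right_injective N hp0
      simp only [← ha, Finset.smul_sum, smul_smul, ← hd]
    rw [this]
    exact Submodule.sum_mem _ fun i _ => Submodule.smul_mem _ _
        (Submodule.subset_span ⟨i, rfl⟩)) ha
  exact hmax _ ⟨b', hb', rfl, hle.trans hlt.le⟩ hlt

end SeshadriAux

/-- For a `ℤ[x]`-lattice `M` (a submodule of `ℤ[x]ⁿ`; such submodules are
automatically finitely generated), the dual `N = Hom_{ℤ[x]}(M, ℤ[x])` is a free
`ℤ[x]`-module whose rank (the dimension over `ℚ(x)` of `ℚ(x) ⊗_{ℤ[x]} N`) equals the rank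
of `M`. -/
theorem statement2 (n : ℕ) (M : Submodule (Polynomial ℤ) (Fin n → Polynomial ℤ)) :
    Module.Free (Polynomial ℤ) (M →ₗ[Polynomial ℤ] Polynomial ℤ) ∧
    Module.rank (FractionRing (Polynomial ℤ))
        (FractionRing (Polynomial ℤ) ⊗[Polynomial ℤ] (M →ₗ[Polynomial ℤ] Polynomial ℤ))
      = Module.rank (FractionRing (Polynomial ℤ))
          (FractionRing (Polynomial ℤ) ⊗[Polynomial ℤ] M) := by
  have hfin : Module.Finite ℤ[X] M := inferInstance
  have hfp : Module.FinitePresentation ℤ[X] M := Module.finitePresentation_of_finite _ _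
  constructor
  · have : Module.Finite ℤ[X] (M →ₗ[ℤ[X]] ℤ[X]) := by
      have : IsNoetherian ℤ[X] (M →ₗ[ℤ[X]] ℤ[X]) := inferInstance
      infer_instance
    apply SeshadriAux.free_of_saturated
    intro p hp a f g hpa hfg
    have hprime : Prime (C (p : ℤ)) := Polynomial.prime_C_iff.mpr (Nat.prime_iff_prime_int.mp hp)
    have hdvd : ∀ m, C (p : ℤ) ∣ f m := by
      intro m
      have h1 : a * f m = C (p : ℤ) * g m := by
        simpa only [LinearMap.smul_apply, smul_eq_mul] using LinearMap.congr_fun hfg m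
      exact (hprime.dvd_or_dvd ⟨_, h1⟩).resolve_left hpa
    choose c hc using hdvd
    refine ⟨{ toFun := c, map_add' := ?_, map_smul' := ?_ }, ?_⟩
    · intro x y
      apply mul_left_cancel₀ hprime.ne_zero
      rw [← hc, map_add, mul_add, ← hc, ← hc]
    · intro r x
      apply mul_left_cancel₀ hprime.ne_zero
      rw [← hc, map_smul, hc x]
      simp only [smul_eq_mul, RingHom.id_apply]
      ring
    · ext1 m
      exact hc m
  · let K := FractionRing ℤ[X]
    let S := nonZeroDivisors ℤ[X]
    let f : M →ₗ[ℤ[X]] K ⊗[ℤ[X]] M := TensorProduct.mk ℤ[X] K M 1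
    have hf : IsLocalizedModule S f :=
      (isLocalizedModule_iff_isBaseChange S K _).mpr (TensorProduct.isBaseChange _ _ _)
    let g : ℤ[X] →ₗ[ℤ[X]] K := Algebra.linearMap _ _
    have hg : IsLocalizedModule S g := inferInstance
    have hmap := Module.FinitePresentation.isLocalizedModule_mapExtendScalars S f g K
    have e := ((isLocalizedModule_iff_isBaseChange S K _).mp hmap).equiv
    rw [e.rank_eq]
    rw [← Module.finrank_eq_rank, ← Module.finrank_eq_rank]
    congr 1
    exact Subspace.dual_finrank_eq
end

section
/- Let L ⊆ ℤ[x]^m be a toric ℤ[x]-lattice, i.e., a ℤ[x]-submodule such that for every nonzero g ∈ ℤ[x] and u ∈ ℤ[x]^m, g·u ∈ L implies u ∈ L. Let L^C := {u ∈ ℤ[x]^m : ⟨u, v⟩ = 0 for all v ∈ L}. Then (L^C)^C = L. -/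
open Polynomial

/-- The "complement" `L^C = {u : ⟨u, v⟩ = 0 for all v ∈ L}` of a `ℤ[x]`-lattice
`L ⊆ ℤ[x]^m`, as a `ℤ[x]`-submodule. -/
noncomputable def latticeComplement (m : ℕ) (L : Submodule (Polynomial ℤ) (Fin m → Polynomial ℤ)) :
    Submodule (Polynomial ℤ) (Fin m → Polynomial ℤ) where
  carrier := {u | ∀ v ∈ L, ∑ i, u i * v i = 0}
  zero_mem' := by intro v _; simp
  add_mem' := by
    intro a b ha hb v hv
    simp only [Set.mem_setOf_eq, Pi.add_apply, add_mul, Finset.sum_add_distrib,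
      ha v hv, hb v hv, add_zero]
  smul_mem' := by
    intro c a ha v hv
    have h := ha v hv
    simp only [Pi.smul_apply, smul_eq_mul, mul_assoc, ← Finset.mul_sum, h, mul_zero]

theorem span_clear_denominators (m : ℕ) (L : Submodule (Polynomial ℤ) (Fin m → Polynomial ℤ))
    (y : Fin m → FractionRing (Polynomial ℤ))
    (hy : y ∈ Submodule.span (FractionRing (Polynomial ℤ))
      (Set.image (fun v : Fin m → Polynomial ℤ =>
        fun i => algebraMap (Polynomial ℤ) (FractionRing (Polynomial ℤ)) (v i)) (L : Set _))) :
    ∃ g : Polynomial ℤ, g ≠ 0 ∧ ∃ v ∈ L, ∀ i,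
      algebraMap (Polynomial ℤ) (FractionRing (Polynomial ℤ)) g * y i
        = algebraMap (Polynomial ℤ) (FractionRing (Polynomial ℤ)) (v i) := by
  induction hy using Submodule.span_induction with
  | mem x hx =>
    obtain ⟨v, hv, rfl⟩ := hx
    exact ⟨1, one_ne_zero, v, hv, fun i => by simp⟩
  | zero => exact ⟨1, one_ne_zero, 0, L.zero_mem, fun i => by simp⟩
  | add x y _ _ hx hy =>
    obtain ⟨g, hg, v, hv, h⟩ := hx
    obtain ⟨g', hg', v', hv', h'⟩ := hy
    refine ⟨g * g', mul_ne_zero hg hg', g' • v + g • v',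
      L.add_mem (L.smul_mem _ hv) (L.smul_mem _ hv'), fun i => ?_⟩
    simp only [Pi.add_apply, Pi.smul_apply, smul_eq_mul, map_add, map_mul, ← h, ← h']
    ring
  | smul a x _ hx =>
    obtain ⟨g, hg, v, hv, h⟩ := hx
    obtain ⟨n, d, hd, rfl⟩ := IsFractionRing.div_surjective (A := Polynomial ℤ) a
    have hd0 : d ≠ 0 := nonZeroDivisors.ne_zero hd
    have hd1 : algebraMap (Polynomial ℤ) (FractionRing (Polynomial ℤ)) d ≠ 0 := by
      simpa using hd0
    refine ⟨d * g, mul_ne_zero hd0 hg, n • v, L.smul_mem _ hv, fun i => ?_⟩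
    simp only [Pi.smul_apply, smul_eq_mul, map_mul, ← h]
    field_simp

/-- If `L ⊆ ℤ[x]^m` is a toric `ℤ[x]`-lattice, i.e. `g • u ∈ L` implies
`u ∈ L` for every nonzero `g ∈ ℤ[x]`, then `(L^C)^C = L`. -/
theorem statement4 (m : ℕ) (L : Submodule (Polynomial ℤ) (Fin m → Polynomial ℤ))
    (hL : ∀ (g : Polynomial ℤ), g ≠ 0 → ∀ u : Fin m → Polynomial ℤ, g • u ∈ L → u ∈ L) :
    latticeComplement m (latticeComplement m L) = L := by
  have hinj := IsFractionRing.injective (Polynomial ℤ) (FractionRing (Polynomial ℤ))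
  apply le_antisymm
  · intro u hu
    by_contra huL
    have hnot : (fun i => algebraMap (Polynomial ℤ) (FractionRing (Polynomial ℤ)) (u i)) ∉
        Submodule.span (FractionRing (Polynomial ℤ))
      (Set.image (fun v : Fin m → Polynomial ℤ =>
        fun i => algebraMap (Polynomial ℤ) (FractionRing (Polynomial ℤ)) (v i)) (L : Set _)) := by
      intro hmem
      obtain ⟨g, hg, v, hv, h⟩ := span_clear_denominators m L _ hmem
      apply huL
      apply hL g hg
      have : g • u = v := by
        funext i
        apply hinj
        simpa using h i
      rwa [this]
    obtain ⟨f, hf, hker⟩ := Submodule.exists_le_ker_of_notMem hnot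
    obtain ⟨b, hb⟩ := IsLocalization.exist_integer_multiples_of_finite
      (nonZeroDivisors (Polynomial ℤ)) (fun i : Fin m => f (Pi.single i 1))
    choose w hw using hb
    have key : ∀ v : Fin m → Polynomial ℤ,
        algebraMap (Polynomial ℤ) (FractionRing (Polynomial ℤ)) (∑ i, w i * v i) =
        algebraMap (Polynomial ℤ) (FractionRing (Polynomial ℤ)) b *
          f (fun i => algebraMap (Polynomial ℤ) (FractionRing (Polynomial ℤ)) (v i)) := by
      intro v
      rw [LinearMap.pi_apply_eq_sum_univ f, map_sum, Finset.mul_sum]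
      refine Finset.sum_congr rfl fun i _ => ?_
      have e : (fun j => if i = j then (1 : FractionRing (Polynomial ℤ)) else 0)
          = Pi.single i 1 := by
        funext j
        simp [Pi.single_apply, eq_comm]
      rw [e, map_mul, hw i, Algebra.smul_def, smul_eq_mul]
      ring
    have hwL : w ∈ latticeComplement m L := by
      intro v hv
      apply hinj
      have h0 := hker (Submodule.subset_span ⟨v, hv, rfl⟩)
      rw [LinearMap.mem_ker] at h0
      rw [key v, h0, mul_zero, map_zero]
    have h1 := hu w hwL
    have h2 := key u
    have h3 : ∑ i, w i * u i = 0 := by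
      rw [← h1]
      exact Finset.sum_congr rfl fun i _ => mul_comm _ _
    rw [h3, map_zero] at h2
    rcases mul_eq_zero.mp h2.symm with h | h
    · exact nonZeroDivisors.ne_zero b.2 (hinj (by rw [h, map_zero]))
    · exact hf h
  · intro u hu v hv
    rw [← hv u hu]
    exact Finset.sum_congr rfl fun i _ => mul_comm _ _
end

section
/- Let S = P[x](U) be the affine P[x]-semimodule generated by a finite set U = {u_1,…,u_m} ⊂ ℤ[x]^n, and let F be a face of S. Then F = P[x]({u_i : u_i ∈ F}), i.e., F is generated as a P[x]-semimodule by the subset of the generators u_1,…,u_m that lie in F. In particular, S has only finitely many faces. -/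
open Polynomial

/-- `P[x] = {f ∈ ℤ[x] : f = 0 or the leading coefficient of f is positive}`. -/
def PxSet : Set (Polynomial ℤ) := {f | f = 0 ∨ 0 < f.leadingCoeff}

/-- The affine `P[x]`-semimodule `P[x](U) = {Σ gᵢ • uᵢ : gᵢ ∈ P[x]}` generated by
`u₁, …, u_m ∈ ℤ[x]ⁿ`. -/
def PxSpan {m n : ℕ} (u : Fin m → (Fin n → Polynomial ℤ)) : Set (Fin n → Polynomial ℤ) :=
  {s | ∃ g : Fin m → Polynomial ℤ, (∀ i, g i ∈ PxSet) ∧ s = ∑ i, g i • u i}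

/-- `F` is a face of `S`: a `P[x]`-subsemimodule of `S` (containing `0`, closed under
addition and under scalar multiplication by elements of `P[x]`) such that
(1) `u₁ + u₂ ∈ F` with `u₁, u₂ ∈ S` implies `u₁, u₂ ∈ F`; and
(2) `g • u ∈ F` with `g ∈ P[x] ∖ {0}` and `u ∈ S` implies `u ∈ F`. -/
def IsFace {n : ℕ} (S F : Set (Fin n → Polynomial ℤ)) : Prop :=
  F ⊆ S ∧ (0 : Fin n → Polynomial ℤ) ∈ F ∧
  (∀ a ∈ F, ∀ b ∈ F, a + b ∈ F) ∧
  (∀ g ∈ PxSet, ∀ a ∈ F, g • a ∈ F) ∧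
  (∀ a ∈ S, ∀ b ∈ S, a + b ∈ F → a ∈ F ∧ b ∈ F) ∧
  (∀ g ∈ PxSet, g ≠ 0 → ∀ a ∈ S, g • a ∈ F → a ∈ F)

/-- The rank of a subset `F ⊆ ℤ[x]ⁿ`: the dimension over `ℚ(x)` (the fraction field of
`ℤ[x]`) of the `ℚ(x)`-span of (the image of) `F` in `ℚ(x)ⁿ`. -/
noncomputable def rkSet {n : ℕ} (F : Set (Fin n → Polynomial ℤ)) : ℕ :=
  Module.finrank (FractionRing (Polynomial ℤ))
    (Submodule.span (FractionRing (Polynomial ℤ))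
      ((fun v (j : Fin n) => algebraMap (Polynomial ℤ) (FractionRing (Polynomial ℤ)) (v j)) '' F))

theorem face_gen_aux {m n : ℕ} (u : Fin m → (Fin n → Polynomial ℤ))
    (F : Set (Fin n → Polynomial ℤ)) (hF : IsFace (PxSpan u) F) :
    F = {s | ∃ g : Fin m → Polynomial ℤ, (∀ i, g i ∈ PxSet) ∧
        (∀ i, u i ∉ F → g i = 0) ∧ s = ∑ i, g i • u i} := by
  classical
  obtain ⟨hsub, h0, hadd, hsmul, hface, hdiv⟩ := hF
  have zero_mem : (0 : Polynomial ℤ) ∈ PxSet := Or.inl rfl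
  have one_mem : (1 : Polynomial ℤ) ∈ PxSet := Or.inr (by simp)
  have single : ∀ (g : Polynomial ℤ) (i : Fin m), g ∈ PxSet → g • u i ∈ PxSpan u := by
    intro g i hg
    refine ⟨fun j => if j = i then g else 0, ?_, ?_⟩
    · intro j
      dsimp only
      split_ifs
      · exact hg
      · exact zero_mem
    · simp [ite_smul]
  ext s
  constructor
  · intro hs
    obtain ⟨g, hg, rfl⟩ := hsub hs
    refine ⟨g, hg, ?_, rfl⟩
    intro i hi
    by_contra hgi
    apply hi
    have hrest : ∑ j ∈ Finset.univ.erase i, g j • u j ∈ PxSpan u := by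
      refine ⟨fun j => if j = i then 0 else g j, ?_, ?_⟩
      · intro j
        dsimp only
        split_ifs
        · exact zero_mem
        · exact hg j
      · rw [← Finset.add_sum_erase _ _ (Finset.mem_univ i)]
        simp only [if_true, zero_smul, zero_add]
        refine Finset.sum_congr rfl fun j hj => ?_
        rw [if_neg (Finset.ne_of_mem_erase hj)]
    rw [← Finset.add_sum_erase _ _ (Finset.mem_univ i)] at hs
    have h1 := (hface _ (single _ i (hg i)) _ hrest hs).1
    have h2 := single 1 i one_mem
    rw [one_smul] at h2
    exact hdiv _ (hg i) hgi _ h2 h1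
  · rintro ⟨g, hg, hz, rfl⟩
    refine Finset.sum_induction _ (· ∈ F) (fun a b ha hb => hadd a ha b hb) h0 ?_
    intro i _
    by_cases hi : u i ∈ F
    · exact hsmul _ (hg i) _ hi
    · rw [hz i hi, zero_smul]
      exact h0

/-- Let `S = P[x](U)` be the affine `P[x]`-semimodule generated by
`u₁, …, u_m ∈ ℤ[x]ⁿ` and let `F` be a face of `S`.  Then `F` is generated, as a
`P[x]`-semimodule, by those generators `uᵢ` that lie in `F`; in particular `S` has only
finitely many faces. -/
theorem statement10 (m n : ℕ) (u : Fin m → (Fin n → Polynomial ℤ))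
    (S F : Set (Fin n → Polynomial ℤ)) (hS : S = PxSpan u) (hF : IsFace S F) :
    (F = {s | ∃ g : Fin m → Polynomial ℤ, (∀ i, g i ∈ PxSet) ∧
        (∀ i, u i ∉ F → g i = 0) ∧ s = ∑ i, g i • u i}) ∧
    {F' : Set (Fin n → Polynomial ℤ) | IsFace S F'}.Finite := by
  subst hS
  refine ⟨face_gen_aux u F hF, ?_⟩
  refine Set.Finite.of_finite_image (f := fun F' => {i | u i ∈ F'}) (Set.toFinite _) ?_
  intro A hA B hB hAB
  have h : ∀ i, u i ∈ A ↔ u i ∈ B := fun i => Set.ext_iff.mp hAB i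
  rw [face_gen_aux u A hA, face_gen_aux u B hB]
  simp only [h]
end

section
/- Let S ⊆ ℤ[x]^n be an affine P[x]-semimodule and F a proper face of S (i.e., a face with F ≠ S). Then rank(F) < rank(S). -/
open Polynomial

theorem px_mul {f g : Polynomial ℤ} (hf : f ∈ PxSet) (hg : g ∈ PxSet) : f * g ∈ PxSet := by
  rcases hf with rfl | hf
  · left; simp
  rcases hg with rfl | hg
  · left; simp
  right
  rw [Polynomial.leadingCoeff_mul]
  exact mul_pos hf hg

theorem px_total (f : Polynomial ℤ) : f ∈ PxSet ∨ -f ∈ PxSet := by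
  rcases lt_trichotomy f.leadingCoeff 0 with h | h | h
  · right; right
    rw [Polynomial.leadingCoeff_neg]; omega
  · left; left
    exact Polynomial.leadingCoeff_eq_zero.mp h
  · left; right; exact h

theorem px_one : (1 : Polynomial ℤ) ∈ PxSet := by
  right; simp

theorem pxSpan_smul {m n : ℕ} (u : Fin m → (Fin n → Polynomial ℤ)) {g : Polynomial ℤ}
    (hg : g ∈ PxSet) {s : Fin n → Polynomial ℤ} (hs : s ∈ PxSpan u) : g • s ∈ PxSpan u := by
  obtain ⟨c, hc, rfl⟩ := hs
  refine ⟨fun i => g * c i, fun i => px_mul hg (hc i), ?_⟩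
  simp only [Finset.smul_sum, mul_smul]

theorem span_repr {n : ℕ} (F : Set (Fin n → Polynomial ℤ)) (h0 : (0 : Fin n → Polynomial ℤ) ∈ F)
    (hadd : ∀ a ∈ F, ∀ b ∈ F, a + b ∈ F) (hsm : ∀ g ∈ PxSet, ∀ a ∈ F, g • a ∈ F)
    (v : Fin n → FractionRing (Polynomial ℤ))
    (hv : v ∈ Submodule.span (FractionRing (Polynomial ℤ))
      ((fun v (j : Fin n) => algebraMap (Polynomial ℤ) (FractionRing (Polynomial ℤ)) (v j)) '' F)) :
    ∃ d ∈ PxSet, d ≠ 0 ∧ ∃ a ∈ F, ∃ b ∈ F, ∀ j,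
      algebraMap (Polynomial ℤ) (FractionRing (Polynomial ℤ)) d * v j =
        algebraMap (Polynomial ℤ) (FractionRing (Polynomial ℤ)) (a j - b j) := by
  induction hv using Submodule.span_induction with
  | mem x hx =>
    obtain ⟨a, ha, rfl⟩ := hx
    exact ⟨1, px_one, one_ne_zero, a, ha, 0, h0, fun j => by simp⟩
  | zero => exact ⟨1, px_one, one_ne_zero, 0, h0, 0, h0, fun j => by simp⟩
  | add x y _ _ hx hy =>
    obtain ⟨d, hd, hd0, a, ha, b, hb, h⟩ := hx
    obtain ⟨e, he, he0, a', ha', b', hb', h'⟩ := hy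
    refine ⟨d * e, px_mul hd he, mul_ne_zero hd0 he0, e • a + d • a',
      hadd _ (hsm e he a ha) _ (hsm d hd a' ha'), e • b + d • b',
      hadd _ (hsm e he b hb) _ (hsm d hd b' hb'), fun j => ?_⟩
    have h1 := h j
    have h2 := h' j
    simp only [Pi.add_apply, Pi.smul_apply, smul_eq_mul, map_add, map_sub, map_mul] at h1 h2 ⊢
    linear_combination (algebraMap (Polynomial ℤ) (FractionRing (Polynomial ℤ)) e) * h1 +
      (algebraMap (Polynomial ℤ) (FractionRing (Polynomial ℤ)) d) * h2
  | smul c x _ hx =>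
    obtain ⟨d, hd, hd0, a, ha, b, hb, h⟩ := hx
    have hc : ∃ p q : Polynomial ℤ, q ∈ PxSet ∧ q ≠ 0 ∧
        algebraMap (Polynomial ℤ) (FractionRing (Polynomial ℤ)) q * c =
          algebraMap (Polynomial ℤ) (FractionRing (Polynomial ℤ)) p := by
      obtain ⟨p, q, hq, rfl⟩ := IsFractionRing.div_surjective (A := Polynomial ℤ) c
      have hq0 : q ≠ 0 := nonZeroDivisors.ne_zero hq
      have hq1 : algebraMap (Polynomial ℤ) (FractionRing (Polynomial ℤ)) q ≠ 0 := by
        simpa using hq0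
      rcases px_total q with hs | hs
      · exact ⟨p, q, hs, hq0, by field_simp⟩
      · exact ⟨-p, -q, hs, neg_ne_zero.mpr hq0, by rw [map_neg, map_neg]; field_simp⟩
    obtain ⟨p, q, hq, hq0, hc⟩ := hc
    rcases px_total p with hp | hp
    · refine ⟨q * d, px_mul hq hd, mul_ne_zero hq0 hd0, p • a, hsm p hp a ha, p • b,
        hsm p hp b hb, fun j => ?_⟩
      have h1 := h j
      simp only [Pi.smul_apply, smul_eq_mul, map_sub, map_mul] at h1 ⊢
      rw [← hc]
      linear_combination (algebraMap (Polynomial ℤ) (FractionRing (Polynomial ℤ)) q) * c * h1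
    · refine ⟨q * d, px_mul hq hd, mul_ne_zero hq0 hd0, (-p) • b, hsm _ hp b hb, (-p) • a,
        hsm _ hp a ha, fun j => ?_⟩
      have h1 := h j
      simp only [Pi.smul_apply, smul_eq_mul, map_sub, map_mul, map_neg] at h1 ⊢
      rw [← hc]
      linear_combination (algebraMap (Polynomial ℤ) (FractionRing (Polynomial ℤ)) q) * c * h1

/-- Let `S ⊆ ℤ[x]ⁿ` be an affine `P[x]`-semimodule and `F` a proper face
of `S`.  Then `rank F < rank S`. -/
theorem statement11 (m n : ℕ) (u : Fin m → (Fin n → Polynomial ℤ))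
    (S F : Set (Fin n → Polynomial ℤ)) (hS : S = PxSpan u) (hF : IsFace S F)
    (hproper : F ≠ S) :
    rkSet F < rkSet S := by
  obtain ⟨hsub, h0, hadd, hsm, h1, h2⟩ := hF
  unfold rkSet
  apply Submodule.finrank_lt_finrank_of_lt
  refine lt_of_le_of_ne (Submodule.span_mono (Set.image_mono hsub)) fun heq => hproper ?_
  refine Set.Subset.antisymm hsub fun s hs => ?_
  have hv := Submodule.subset_span (R := FractionRing (Polynomial ℤ)) (Set.mem_image_of_mem
    (fun v (j : Fin n) => algebraMap (Polynomial ℤ) (FractionRing (Polynomial ℤ)) (v j)) hs)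
  rw [← heq] at hv
  obtain ⟨d, hd, hd0, a, ha, b, hb, h⟩ := span_repr F h0 hadd hsm _ hv
  have hab : d • s + b = a := by
    funext j
    have h3 := h j
    rw [← map_mul] at h3
    have h4 := IsFractionRing.injective (Polynomial ℤ) (FractionRing (Polynomial ℤ)) h3
    simp only [Pi.add_apply, Pi.smul_apply, smul_eq_mul]
    rw [h4]; ring
  have hds : d • s ∈ S := by
    subst hS; exact pxSpan_smul u hd hs
  exact h2 d hd hd0 s hs (h1 _ hds b (hsub hb) (by rw [hab]; exact ha)).1
end
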